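/- Equivalence of the Cauchy and spherical correlation inequalities: for every n ≥ 1 the following two statements are equivalent. (i) For all symmetric convex sets K, M ⊆ ℝ^n: ν_n(K ∩ M) ≥ ν_n(K)·ν_n(M). (ii) For all symmetric convex sets K, M ⊆ ℝ^n: μ_n(q(K) ∩ q(M))·μ_n(S^n_+) ≥ μ_n(q(K))·μ_n(q(M)). (The sets of the form q(K) with K ⊆ ℝ^n symmetric convex are exactly the geodesically convex subsets of the open hemisphere that are centrally symmetric about the pole o, so (ii) is the spherical correlation conjecture.) -/

import Mathlib

open MeasureTheory Real
open scoped RealInnerProductSpace ENNReal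

/-- Density (up to constant) of the Cauchy measure on `ℝⁿ`. -/
noncomputable def cauchyDensity (n : ℕ) (x : EuclideanSpace ℝ (Fin n)) : ℝ :=
  (1 + ‖x‖ ^ 2) ^ (-(((n : ℝ) + 1) / 2))

/-- Normalizing constant of the Cauchy measure. -/
noncomputable def cauchyConst (n : ℕ) : ℝ :=
  (∫ x : EuclideanSpace ℝ (Fin n), cauchyDensity n x)⁻¹

/-- The Cauchy measure `ν_n` on `ℝⁿ`. -/
noncomputable def cauchyMeasure (n : ℕ) : Measure (EuclideanSpace ℝ (Fin n)) :=
  volume.withDensity fun x => ENNReal.ofReal (cauchyConst n * cauchyDensity n x)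

/-- Gnomonic projection of `ℝⁿ` onto the open upper hemisphere of `Sⁿ ⊆ ℝ^{n+1}`. -/
noncomputable def gnomonic (n : ℕ) (x : EuclideanSpace ℝ (Fin n)) :
    EuclideanSpace ℝ (Fin (n + 1)) :=
  (Real.sqrt (1 + ‖x‖ ^ 2))⁻¹ •
    ((EuclideanSpace.equiv (Fin (n + 1)) ℝ).symm (Fin.snoc (fun i => x i) 1))

/-- The pole `o = e_{n+1}`. -/
noncomputable def pole (n : ℕ) : EuclideanSpace ℝ (Fin (n + 1)) :=
  EuclideanSpace.single (Fin.last n) 1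

/-- The unit sphere `Sⁿ ⊆ ℝ^{n+1}` as a set. -/
noncomputable def unitSphereSet (n : ℕ) : Set (EuclideanSpace ℝ (Fin (n + 1))) :=
  Metric.sphere 0 1

/-- The open hemisphere `Sⁿ₊` centered at the pole. -/
noncomputable def hemisphere (n : ℕ) : Set (EuclideanSpace ℝ (Fin (n + 1))) :=
  {y ∈ unitSphereSet n | 0 < ⟪y, pole n⟫}


open Filter Topology Module
open scoped NNReal

/-- If the distances between values of `f` on `t` are controlled by those between values of `g`,
then so are the Hausdorff measures of the images of `t`. -/
theorem hausdorffMeasure_image_le_of_edist_le {α X Y : Type*} [EMetricSpace X] [MeasurableSpace X]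
    [BorelSpace X] [EMetricSpace Y] [MeasurableSpace Y] [BorelSpace Y] {f : α → X} {g : α → Y}
    {t : Set α} {k : ℝ≥0} (h : ∀ y ∈ t, ∀ z ∈ t, edist (f y) (f z) ≤ k * edist (g y) (g z))
    {d : ℝ} (hd : 0 ≤ d) : μH[d] (f '' t) ≤ (k : ℝ≥0∞) ^ d * μH[d] (g '' t) := by
  rcases isEmpty_or_nonempty α with hα | hα
  · simp [Set.eq_empty_of_isEmpty t]
  have hinv : ∀ y ∈ t, Function.invFunOn g t (g y) ∈ t ∧ g (Function.invFunOn g t (g y)) = g y :=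
    fun y hy => Function.invFunOn_pos ⟨y, hy, rfl⟩
  have hlip : LipschitzOnWith k (f ∘ Function.invFunOn g t) (g '' t) := by
    rintro _ ⟨y, hy, rfl⟩ _ ⟨z, hz, rfl⟩
    simpa [(hinv y hy).2, (hinv z hz).2] using h _ (hinv y hy).1 _ (hinv z hz).1
  convert hlip.hausdorffMeasure_image_le hd using 2
  rw [Set.image_image]
  refine Set.image_congr fun y hy => ?_
  have := h _ hy _ (hinv y hy).1
  rw [(hinv y hy).2, edist_self, mul_zero, nonpos_iff_eq_zero, edist_eq_zero] at this
  exact this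

section AreaFormula

variable {U V : Type*} [NormedAddCommGroup U] [InnerProductSpace ℝ U] [FiniteDimensional ℝ U]
  [MeasurableSpace U] [BorelSpace U] [NormedAddCommGroup V] [InnerProductSpace ℝ V]
  [MeasurableSpace V] [BorelSpace V]

/-- Near a point where the strict derivative `L` of `q` is injective, `q` distorts Hausdorff measure
by a factor arbitrarily close to `L.normDet`. -/
theorem HasStrictFDerivAt.hausdorffMeasure_image_bounds {q : U → V} {L : U →L[ℝ] V} {x : U}
    (hq : HasStrictFDerivAt q L x) (hL : Function.Injective L) {k : ℝ≥0} (hk : 1 < k) :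
    ∃ s ∈ 𝓝 x, ∀ t ⊆ s,
      μH[finrank ℝ U] (q '' t) ≤
        (k : ℝ≥0∞) ^ finrank ℝ U * (ENNReal.ofReal L.normDet * μH[finrank ℝ U] t) ∧
      ENNReal.ofReal L.normDet * μH[finrank ℝ U] t ≤
        (k : ℝ≥0∞) ^ finrank ℝ U * μH[finrank ℝ U] (q '' t) := by
  obtain ⟨K, hK, hLK⟩ := L.toLinearMap.injective_iff_antilipschitz.1 hL
  have hk' : (1 : ℝ) < k := hk
  have hK' : (0 : ℝ) < K := hK
  obtain ⟨c, hc, hc1, hc2⟩ : ∃ c : ℝ, 0 < c ∧ c * K ≤ k - 1 ∧ 1 ≤ k * (1 - c * K) := by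
    refine ⟨(1 - (k : ℝ)⁻¹) / K, by have := inv_lt_one_of_one_lt₀ hk'; bound, ?_, ?_⟩
    · rw [div_mul_cancel₀ _ hK'.ne']
      have : (k : ℝ) * (k : ℝ)⁻¹ = 1 := mul_inv_cancel₀ (by positivity)
      nlinarith [inv_pos.2 (zero_lt_one.trans hk')]
    · rw [div_mul_cancel₀ _ hK'.ne', sub_sub_cancel, mul_inv_cancel₀ (by positivity)]
  obtain ⟨s, hs, hqs⟩ := hq.approximates_deriv_on_nhds (c := ⟨c, hc.le⟩) (Or.inr hc)
  have key : ∀ y ∈ s, ∀ z ∈ s, dist (q y) (q z) ≤ k * dist (L y) (L z) ∧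
      dist (L y) (L z) ≤ k * dist (q y) (q z) := by
    intro y hy z hz
    have h1 : ‖q y - q z - L (y - z)‖ ≤ c * ‖y - z‖ := hqs y hy z hz
    have h2 : ‖y - z‖ ≤ K * ‖L (y - z)‖ := by
      have := hLK.le_mul_dist y z
      simpa [dist_eq_norm] using this
    have h3 : c * ‖y - z‖ ≤ c * K * ‖L (y - z)‖ := by
      rw [mul_assoc]; gcongr
    have h4 : ‖q y - q z‖ ≤ ‖q y - q z - L (y - z)‖ + ‖L (y - z)‖ := by
      simpa using norm_add_le (q y - q z - L (y - z)) (L (y - z))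
    have h5 : ‖L (y - z)‖ ≤ ‖q y - q z‖ + ‖q y - q z - L (y - z)‖ := by
      simpa using norm_sub_le (q y - q z) (q y - q z - L (y - z))
    rw [dist_eq_norm, dist_eq_norm, ← map_sub]
    have h0 := norm_nonneg (L (y - z))
    constructor
    · nlinarith
    · have : (1 - c * K) * ‖L (y - z)‖ ≤ ‖q y - q z‖ := by linarith
      nlinarith
  have toE : ∀ {a b : ℝ≥0∞} {a' b' : ℝ}, a = ENNReal.ofReal a' → b = ENNReal.ofReal b' →
      a' ≤ k * b' → a ≤ k * b := by
    rintro _ _ a' b' rfl rfl h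
    rw [← ENNReal.ofReal_coe_nnreal (p := k), ← ENNReal.ofReal_mul k.coe_nonneg]
    exact ENNReal.ofReal_le_ofReal h
  refine ⟨s, hs, fun t ht => ?_⟩
  have hn : (0 : ℝ) ≤ finrank ℝ U := Nat.cast_nonneg _
  have hLt : μH[finrank ℝ U] (L '' t) = ENNReal.ofReal L.normDet * μH[finrank ℝ U] t :=
    L.toLinearMap.hausdorffMeasure_image t
  rw [← hLt, ← ENNReal.rpow_natCast]
  exact ⟨hausdorffMeasure_image_le_of_edist_le (fun y hy z hz =>
      toE (edist_dist _ _) (edist_dist _ _) (key y (ht hy) z (ht hz)).1) hn,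
    hausdorffMeasure_image_le_of_edist_le (fun y hy z hz =>
      toE (edist_dist _ _) (edist_dist _ _) (key y (ht hy) z (ht hz)).2) hn⟩

theorem HasStrictFDerivAt.tendsto_hausdorffMeasure_image_closedBall_div {q : U → V} {L : U →L[ℝ] V}
    {x : U} (hq : HasStrictFDerivAt q L x) (hL : Function.Injective L) :
    Tendsto (fun r => μH[finrank ℝ U] (q '' Metric.closedBall x r) /
      μH[finrank ℝ U] (Metric.closedBall x r)) (𝓝[>] 0) (𝓝 (ENNReal.ofReal L.normDet)) := by
  set J := ENNReal.ofReal L.normDet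
  have bounds : ∀ k : ℝ≥0, 1 < k → ∀ᶠ r in 𝓝[>] (0 : ℝ),
      μH[finrank ℝ U] (q '' Metric.closedBall x r) / μH[finrank ℝ U] (Metric.closedBall x r) ≤
        (k : ℝ≥0∞) ^ finrank ℝ U * J ∧
      J ≤ (k : ℝ≥0∞) ^ finrank ℝ U * (μH[finrank ℝ U] (q '' Metric.closedBall x r) /
        μH[finrank ℝ U] (Metric.closedBall x r)) := by
    intro k hk
    obtain ⟨s, hs, hst⟩ := hq.hausdorffMeasure_image_bounds hL hk
    obtain ⟨ε, hε, hεs⟩ := Metric.nhds_basis_closedBall.mem_iff.1 hs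
    filter_upwards [Ioc_mem_nhdsGT hε] with r hr
    obtain ⟨h1, h2⟩ := hst _ ((Metric.closedBall_subset_closedBall hr.2).trans hεs)
    have hpos : μH[finrank ℝ U] (Metric.closedBall x r) ≠ 0 :=
      (Metric.measure_closedBall_pos _ _ hr.1).ne'
    have hfin : μH[finrank ℝ U] (Metric.closedBall x r) ≠ ∞ :=
      (isCompact_closedBall x r).measure_lt_top.ne
    rw [← mul_div_assoc, ENNReal.div_le_iff hpos hfin, ENNReal.le_div_iff_mul_le (.inl hpos)
      (.inl hfin), mul_assoc]
    exact ⟨h1, h2⟩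
  have hlim : ∀ a : ℝ≥0∞, a ≠ ∞ →
      Tendsto (fun k : ℝ≥0 => (k : ℝ≥0∞) ^ finrank ℝ U * a) (𝓝[>] 1) (𝓝 a) := by
    intro a ha
    have : Continuous fun k : ℝ≥0 => (k : ℝ≥0∞) ^ finrank ℝ U * a :=
      (ENNReal.continuous_mul_const ha).comp
        ((ENNReal.continuous_pow _).comp ENNReal.continuous_coe)
    simpa using (this.tendsto 1).mono_left nhdsWithin_le_nhds
  have hne : (𝓝[>] (1 : ℝ≥0)).NeBot := nhdsGT_neBot 1
  refine tendsto_order.2 ⟨fun a ha => ?_, fun a ha => ?_⟩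
  · obtain ⟨k, hka, hk⟩ := (((hlim a ha.ne_top).eventually (gt_mem_nhds ha)).and
      self_mem_nhdsWithin).exists
    filter_upwards [bounds k hk] with r hr
    by_contra! hle
    exact absurd (hr.2.trans (by gcongr)) hka.not_ge
  · obtain ⟨k, hka, hk⟩ := (((hlim J ENNReal.ofReal_ne_top).eventually (gt_mem_nhds ha)).and
      self_mem_nhdsWithin).exists
    filter_upwards [bounds k hk] with r hr
    exact hr.1.trans_lt hka

/-- The area formula for injective immersions. -/
theorem comap_hausdorffMeasure_eq_withDensity_normDet {q : U → V} {L : U → U →L[ℝ] V}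
    (hq : ∀ x, HasStrictFDerivAt q (L x) x) (hL : ∀ x, Function.Injective (L x))
    (hinj : Function.Injective q) :
    (μH[finrank ℝ U] : Measure V).comap q =
      (μH[finrank ℝ U] : Measure U).withDensity fun x => ENNReal.ofReal (L x).normDet := by
  have hcont : Continuous q := continuous_iff_continuousAt.2 fun x => (hq x).continuousAt
  have hemb : MeasurableEmbedding q := hcont.measurableEmbedding hinj
  have := FiniteDimensional.proper_real U
  set μ : Measure U := μH[finrank ℝ U]
  set ν : Measure U := (μH[finrank ℝ U] : Measure V).comap q
  have hν : ∀ t, ν t = μH[finrank ℝ U] (q '' t) := hemb.comap_apply _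
  have hbound : ∀ x, ∃ s ∈ 𝓝 x, ∃ C : ℝ≥0∞, C ≠ ∞ ∧ ∀ t ⊆ s, ν t ≤ C * μ t := by
    intro x
    obtain ⟨s, hs, hst⟩ := (hq x).hausdorffMeasure_image_bounds (hL x) one_lt_two
    refine ⟨s, hs, ((2 : ℝ≥0) : ℝ≥0∞) ^ finrank ℝ U * ENNReal.ofReal (L x).normDet,
      ENNReal.mul_ne_top (ENNReal.pow_ne_top ENNReal.coe_ne_top)
      ENNReal.ofReal_ne_top, fun t ht => ?_⟩
    rw [hν, mul_assoc]
    exact (hst t ht).1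
  have hfin : IsLocallyFiniteMeasure ν := by
    refine ⟨fun x => ?_⟩
    obtain ⟨s, hs, C, hC, hst⟩ := hbound x
    obtain ⟨t, ht, htμ⟩ := μ.finiteAt_nhds x
    exact ⟨s ∩ t, inter_mem hs ht, (hst _ Set.inter_subset_left).trans_lt
      (ENNReal.mul_lt_top hC.lt_top ((measure_mono Set.inter_subset_right).trans_lt htμ))⟩
  have hac : ν ≪ μ := by
    intro t ht
    refine measure_null_of_locally_null t fun x _ => ?_
    obtain ⟨s, hs, C, -, hst⟩ := hbound x
    refine ⟨t ∩ s, inter_mem self_mem_nhdsWithin (mem_nhdsWithin_of_mem_nhds hs), ?_⟩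
    have := hst (t ∩ s) Set.inter_subset_right
    rwa [measure_mono_null Set.inter_subset_left ht, mul_zero, nonpos_iff_eq_zero] at this
  rw [← Measure.withDensity_rnDeriv_eq ν μ hac]
  refine withDensity_congr_ae ?_
  filter_upwards [Besicovitch.ae_tendsto_rnDeriv ν μ] with x hx
  simp only [hν] at hx
  exact tendsto_nhds_unique hx ((hq x).tendsto_hausdorffMeasure_image_closedBall_div (hL x))

end AreaFormula

/-- The inclusion `v ↦ (v, 0)` of `ℝⁿ` into `ℝ^{n+1}`. -/
noncomputable def equatorialInclusion (n : ℕ) :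
    EuclideanSpace ℝ (Fin n) →L[ℝ] EuclideanSpace ℝ (Fin (n + 1)) :=
  LinearMap.toContinuousLinearMap
    { toFun := fun v => WithLp.toLp 2 (Fin.snoc (fun i => v i) 0)
      map_add' := fun v w => by
        ext i
        refine Fin.lastCases ?_ (fun i => ?_) i <;> simp
      map_smul' := fun c v => by
        ext i
        refine Fin.lastCases ?_ (fun i => ?_) i <;> simp }

@[simp]
theorem equatorialInclusion_castSucc {n : ℕ} (v : EuclideanSpace ℝ (Fin n)) (i : Fin n) :
    equatorialInclusion n v i.castSucc = v i := by
  simp [equatorialInclusion]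

@[simp]
theorem equatorialInclusion_last {n : ℕ} (v : EuclideanSpace ℝ (Fin n)) :
    equatorialInclusion n v (Fin.last n) = 0 := by
  simp [equatorialInclusion]

@[simp]
theorem inner_equatorialInclusion {n : ℕ} (v w : EuclideanSpace ℝ (Fin n)) :
    ⟪equatorialInclusion n v, equatorialInclusion n w⟫ = ⟪v, w⟫ := by
  simp [PiLp.inner_apply, Fin.sum_univ_castSucc]

@[simp]
theorem inner_pole {n : ℕ} (y : EuclideanSpace ℝ (Fin (n + 1))) :
    ⟪y, pole n⟫ = y (Fin.last n) := by
  simp [pole, EuclideanSpace.inner_single_right]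

theorem inner_pole_left {n : ℕ} (y : EuclideanSpace ℝ (Fin (n + 1))) :
    ⟪pole n, y⟫ = y (Fin.last n) := by
  rw [real_inner_comm, inner_pole]

@[simp]
theorem pole_last (n : ℕ) : pole n (Fin.last n) = 1 := by
  simp [pole]

@[simp]
theorem pole_castSucc {n : ℕ} (i : Fin n) : pole n i.castSucc = 0 := by
  simp [pole]

theorem gnomonic_eq {n : ℕ} (x : EuclideanSpace ℝ (Fin n)) :
    gnomonic n x = (√(1 + ‖x‖ ^ 2))⁻¹ • (equatorialInclusion n x + pole n) := by
  ext i
  refine Fin.lastCases ?_ (fun i => ?_) i <;> simp [gnomonic]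

theorem gnomonic_last {n : ℕ} (x : EuclideanSpace ℝ (Fin n)) :
    gnomonic n x (Fin.last n) = (√(1 + ‖x‖ ^ 2))⁻¹ := by
  simp [gnomonic_eq]

theorem gnomonic_castSucc {n : ℕ} (x : EuclideanSpace ℝ (Fin n)) (i : Fin n) :
    gnomonic n x i.castSucc = (√(1 + ‖x‖ ^ 2))⁻¹ * x i := by
  simp [gnomonic_eq]

theorem gnomonic_injective (n : ℕ) : Function.Injective (gnomonic n) := by
  intro x y h
  have hs : (√(1 + ‖x‖ ^ 2))⁻¹ = (√(1 + ‖y‖ ^ 2))⁻¹ := by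
    rw [← gnomonic_last, ← gnomonic_last, h]
  have hne : (√(1 + ‖y‖ ^ 2))⁻¹ ≠ 0 := by positivity
  ext i
  have := congrArg (fun z => z i.castSucc) h
  simp only [gnomonic_castSucc, hs] at this
  exact mul_left_cancel₀ hne this

theorem range_gnomonic (n : ℕ) : Set.range (gnomonic n) = hemisphere n := by
  ext y
  simp only [hemisphere, unitSphereSet, Set.mem_range, Set.mem_ofPred_eq, mem_sphere_zero_iff_norm,
    inner_pole]
  constructor
  · rintro ⟨x, rfl⟩
    refine ⟨?_, by rw [gnomonic_last]; positivity⟩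
    have hp : 0 < 1 + ‖x‖ ^ 2 := by positivity
    have : ‖equatorialInclusion n x + pole n‖ = √(1 + ‖x‖ ^ 2) := by
      rw [← Real.sqrt_sq (norm_nonneg (equatorialInclusion n x + pole n)),
        ← real_inner_self_eq_norm_sq, ← real_inner_self_eq_norm_sq]
      congr 1
      simp only [inner_add_left, inner_add_right, inner_equatorialInclusion, inner_pole,
        inner_pole_left, equatorialInclusion_last, pole_last]
      ring
    rw [gnomonic_eq, norm_smul, this, norm_inv, Real.norm_of_nonneg (Real.sqrt_nonneg _),
      inv_mul_cancel₀ (Real.sqrt_pos.2 hp).ne']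
  · rintro ⟨hy, hpos⟩
    set a := y (Fin.last n)
    have hsum : ∑ i : Fin n, y i.castSucc ^ 2 + a ^ 2 = 1 := by
      have := EuclideanSpace.norm_sq_eq y
      simpa [hy, Fin.sum_univ_castSucc] using this.symm
    have hx : √(1 + ‖(WithLp.toLp 2 fun i : Fin n => a⁻¹ * y i.castSucc :
        EuclideanSpace ℝ (Fin n))‖ ^ 2) = a⁻¹ := by
      refine (Real.sqrt_eq_iff_eq_sq (by positivity) (inv_pos.2 hpos).le).2 ?_
      simp only [EuclideanSpace.norm_sq_eq, norm_mul, mul_pow, Real.norm_eq_abs, sq_abs,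
        ← Finset.mul_sum]
      field_simp
      linarith
    refine ⟨WithLp.toLp 2 fun i : Fin n => a⁻¹ * y i.castSucc, ?_⟩
    ext i
    refine Fin.lastCases ?_ (fun i => ?_) i
    · rw [gnomonic_last, hx, inv_inv]
    · rw [gnomonic_castSucc, hx, inv_inv]
      exact mul_inv_cancel_left₀ hpos.ne' _

/-- The derivative of the gnomonic projection. -/
noncomputable def gnomonicDeriv (n : ℕ) (x : EuclideanSpace ℝ (Fin n)) :
    EuclideanSpace ℝ (Fin n) →L[ℝ] EuclideanSpace ℝ (Fin (n + 1)) :=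
  (√(1 + ‖x‖ ^ 2))⁻¹ • equatorialInclusion n -
    ((√(1 + ‖x‖ ^ 2))⁻¹ ^ 3 • innerSL ℝ x).smulRight (equatorialInclusion n x + pole n)

theorem hasStrictFDerivAt_gnomonic {n : ℕ} (x : EuclideanSpace ℝ (Fin n)) :
    HasStrictFDerivAt (gnomonic n) (gnomonicDeriv n x) x := by
  have hpos : 0 < 1 + ‖x‖ ^ 2 := by positivity
  have hs : 0 < √(1 + ‖x‖ ^ 2) := Real.sqrt_pos.2 hpos
  have h1 : HasStrictFDerivAt (fun x : EuclideanSpace ℝ (Fin n) => 1 + ‖x‖ ^ 2)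
      (2 • innerSL ℝ x) x := (hasStrictFDerivAt_norm_sq x).const_add 1
  have h2 := ((hasStrictDerivAt_inv hs.ne').comp _ (Real.hasStrictDerivAt_sqrt hpos.ne'))
    |>.comp_hasStrictFDerivAt x h1
  have h3 := h2.smul ((equatorialInclusion n).hasStrictFDerivAt.add_const (pole n) (x := x))
  rw [show gnomonic n = _ from funext gnomonic_eq]
  refine h3.congr_fderiv ?_
  ext1 v
  simp only [gnomonicDeriv, add_apply, sub_apply, smul_apply,
    ContinuousLinearMap.smulRight_apply, innerSL_apply_apply, smul_eq_mul, Function.comp_apply]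
  rw [sub_eq_add_neg, ← neg_smul]
  congr 2
  simp only [nsmul_eq_mul]
  field_simp
  norm_num

theorem inner_gnomonicDeriv {n : ℕ} (x v w : EuclideanSpace ℝ (Fin n)) :
    ⟪gnomonicDeriv n x v, gnomonicDeriv n x w⟫ =
      (1 + ‖x‖ ^ 2)⁻¹ * (⟪v, w⟫ - (1 + ‖x‖ ^ 2)⁻¹ * ⟪x, v⟫ * ⟪x, w⟫) := by
  have hpos : 0 < 1 + ‖x‖ ^ 2 := by positivity
  have hs : (√(1 + ‖x‖ ^ 2))⁻¹ ^ 2 = (1 + ‖x‖ ^ 2)⁻¹ := by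
    rw [inv_pow, Real.sq_sqrt hpos.le]
  have hx : (1 + ‖x‖ ^ 2)⁻¹ * (1 + ‖x‖ ^ 2) = 1 := inv_mul_cancel₀ hpos.ne'
  simp only [gnomonicDeriv, sub_apply, smul_apply,
    ContinuousLinearMap.smulRight_apply, innerSL_apply_apply, smul_eq_mul, inner_sub_left,
    inner_sub_right, inner_smul_left, inner_smul_right, inner_add_left, inner_add_right,
    inner_equatorialInclusion, inner_pole, inner_pole_left, equatorialInclusion_last, pole_last,
    RCLike.conj_to_real]
  rw [real_inner_self_eq_norm_sq, real_inner_comm x v]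
  generalize (√(1 + ‖x‖ ^ 2))⁻¹ = h at *
  rw [← hs] at hx ⊢
  linear_combination h ^ 4 * ⟪x, v⟫ * ⟪x, w⟫ * hx

theorem normDet_gnomonicDeriv {n : ℕ} (x : EuclideanSpace ℝ (Fin n)) :
    (gnomonicDeriv n x).normDet = cauchyDensity n x := by
  have hpos : 0 < 1 + ‖x‖ ^ 2 := by positivity
  have hgram : (gnomonicDeriv n x).normDet ^ 2 = (1 + ‖x‖ ^ 2)⁻¹ ^ (n + 1) := by
    have h := (gnomonicDeriv n x).toLinearMap.normDet_sq_eq_det_gram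
      (EuclideanSpace.basisFun (Fin n) ℝ)
    have hmat : Matrix.gram ℝ (fun i => gnomonicDeriv n x (EuclideanSpace.basisFun (Fin n) ℝ i)) =
        (1 + ‖x‖ ^ 2)⁻¹ • (1 + Matrix.replicateCol Unit (fun i => -(1 + ‖x‖ ^ 2)⁻¹ * x i) *
          Matrix.replicateRow Unit (fun i => x i)) := by
      ext i j
      rw [Matrix.gram_apply, inner_gnomonicDeriv]
      simp [Matrix.mul_apply, Matrix.one_apply, EuclideanSpace.inner_single_right,
        eq_comm (a := i) (b := j), sub_eq_add_neg]
    have hdot : (fun i => x i) ⬝ᵥ (fun i => -(1 + ‖x‖ ^ 2)⁻¹ * x i) =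
        -((1 + ‖x‖ ^ 2)⁻¹ * ‖x‖ ^ 2) := by
      rw [EuclideanSpace.norm_sq_eq, Finset.mul_sum, ← Finset.sum_neg_distrib]
      refine Finset.sum_congr rfl fun i _ => ?_
      rw [Real.norm_eq_abs, sq_abs]
      ring
    refine h.trans ?_
    change (Matrix.gram ℝ (fun i => gnomonicDeriv n x
      (EuclideanSpace.basisFun (Fin n) ℝ i))).det = _
    rw [hmat, Matrix.det_smul, Matrix.det_one_add_replicateCol_mul_replicateRow, hdot,
      Fintype.card_fin, pow_succ]
    congr 1
    field_simp
    ring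
  rw [← Real.sqrt_sq (gnomonicDeriv n x).toLinearMap.normDet_nonneg, hgram, cauchyDensity,
    Real.sqrt_eq_rpow, ← Real.rpow_natCast, ← Real.rpow_mul (by positivity),
    Real.inv_rpow hpos.le, Real.rpow_neg hpos.le]
  push_cast
  ring_nf

theorem cauchyDensity_pos {n : ℕ} (x : EuclideanSpace ℝ (Fin n)) : 0 < cauchyDensity n x := by
  unfold cauchyDensity
  positivity

theorem gnomonicDeriv_injective {n : ℕ} (x : EuclideanSpace ℝ (Fin n)) :
    Function.Injective (gnomonicDeriv n x) := by
  refine ((gnomonicDeriv n x).toLinearMap.normDet_ne_zero_tfae.out 0 4).1 ?_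
  rw [normDet_gnomonicDeriv]
  exact (cauchyDensity_pos x).ne'

theorem continuous_cauchyDensity (n : ℕ) : Continuous (cauchyDensity n) := by
  unfold cauchyDensity
  exact (by fun_prop : Continuous fun x : EuclideanSpace ℝ (Fin n) => 1 + ‖x‖ ^ 2).rpow_const
    fun x => .inl (by positivity)

theorem integrable_cauchyDensity (n : ℕ) : Integrable (cauchyDensity n) := by
  have := integrable_rpow_neg_one_add_norm_sq (E := EuclideanSpace ℝ (Fin n))
    (μ := volume) (r := n + 1) (by simp)
  unfold cauchyDensity
  simpa only [neg_div] using this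

theorem cauchyConst_pos (n : ℕ) : 0 < cauchyConst n :=
  inv_pos.2 <| integral_pos_of_integrable_nonneg_nonzero (x := 0) (continuous_cauchyDensity n)
    (integrable_cauchyDensity n) (fun x => (cauchyDensity_pos x).le) (cauchyDensity_pos 0).ne'

theorem cauchyMeasure_eq_smul (n : ℕ) :
    cauchyMeasure n = ENNReal.ofReal (cauchyConst n) •
      volume.withDensity fun x => ENNReal.ofReal (cauchyDensity n x) := by
  rw [← withDensity_smul _ (continuous_cauchyDensity n).measurable.ennreal_ofReal, cauchyMeasure]
  congr 1
  ext1 x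
  exact ENNReal.ofReal_mul (cauchyConst_pos n).le

theorem cauchyMeasure_univ (n : ℕ) : cauchyMeasure n Set.univ = 1 := by
  rw [cauchyMeasure, withDensity_apply _ .univ, Measure.restrict_univ,
    ← ofReal_integral_eq_lintegral_ofReal ((integrable_cauchyDensity n).const_mul _)
      (.of_forall fun x => (mul_pos (cauchyConst_pos n) (cauchyDensity_pos x)).le),
    integral_const_mul, cauchyConst, inv_mul_cancel₀ (inv_pos.1 (cauchyConst_pos n)).ne',
    ENNReal.ofReal_one]

theorem measurableEmbedding_gnomonic (n : ℕ) : MeasurableEmbedding (gnomonic n) :=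
  (continuous_iff_continuousAt.2
    fun x => (hasStrictFDerivAt_gnomonic x).continuousAt).measurableEmbedding (gnomonic_injective n)

theorem exists_hausdorffMeasure_image_gnomonic_eq (n : ℕ) : ∃ c : ℝ≥0∞, c ≠ 0 ∧ c ≠ ∞ ∧
    ∀ t, μH[(n : ℝ)] (gnomonic n '' t) = c * cauchyMeasure n t := by
  have harea := comap_hausdorffMeasure_eq_withDensity_normDet hasStrictFDerivAt_gnomonic
    gnomonicDeriv_injective (gnomonic_injective n)
  simp only [normDet_gnomonicDeriv, finrank_euclideanSpace_fin] at harea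
  have hhaar : (μH[(n : ℝ)] : Measure (EuclideanSpace ℝ (Fin n))).IsAddHaarMeasure := by
    simpa using isAddHaarMeasure_hausdorffMeasure (E := EuclideanSpace ℝ (Fin n))
  set a := Measure.addHaarScalarFactor (μH[(n : ℝ)] : Measure (EuclideanSpace ℝ (Fin n))) volume
  have ha : (a : ℝ≥0∞) ≠ 0 :=
    ENNReal.coe_ne_zero.2 (Measure.addHaarScalarFactor_pos_of_isAddHaarMeasure _ _).ne'
  have hvol : (μH[(n : ℝ)] : Measure (EuclideanSpace ℝ (Fin n))) = (a : ℝ≥0∞) • volume :=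
    Measure.isAddLeftInvariant_eq_smul _ _
  have hc := cauchyConst_pos n
  have hc0 : ENNReal.ofReal (cauchyConst n) ≠ 0 := (ENNReal.ofReal_pos.2 hc).ne'
  refine ⟨a * (ENNReal.ofReal (cauchyConst n))⁻¹,
    mul_ne_zero ha (ENNReal.inv_ne_zero.2 ENNReal.ofReal_ne_top),
    ENNReal.mul_ne_top ENNReal.coe_ne_top (ENNReal.inv_ne_top.2 hc0), fun t => ?_⟩
  rw [← (measurableEmbedding_gnomonic n).comap_apply, harea, hvol, withDensity_smul_measure,
    cauchyMeasure_eq_smul, Measure.smul_apply, Measure.smul_apply, smul_eq_mul, smul_eq_mul,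
    mul_assoc, ENNReal.inv_mul_cancel_left hc0 ENNReal.ofReal_ne_top]

/-- Equivalence of the Cauchy correlation inequality and the spherical
correlation inequality (transported by the gnomonic projection). -/
theorem cauchy_iff_spherical_correlation (n : ℕ) (hn : 1 ≤ n) :
    (∀ K M : Set (EuclideanSpace ℝ (Fin n)),
        Convex ℝ K → K = -K → Convex ℝ M → M = -M →
        cauchyMeasure n (K ∩ M) ≥ cauchyMeasure n K * cauchyMeasure n M) ↔
      (∀ K M : Set (EuclideanSpace ℝ (Fin n)),
        Convex ℝ K → K = -K → Convex ℝ M → M = -M →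
        μH[(n : ℝ)] ((gnomonic n '' K) ∩ (gnomonic n '' M)) * μH[(n : ℝ)] (hemisphere n) ≥
          μH[(n : ℝ)] (gnomonic n '' K) * μH[(n : ℝ)] (gnomonic n '' M)) := by
  obtain ⟨c, hc0, hc, h⟩ := exists_hausdorffMeasure_image_gnomonic_eq n
  have hhemi : μH[(n : ℝ)] (hemisphere n) = c := by
    rw [← range_gnomonic, ← Set.image_univ, h, cauchyMeasure_univ, mul_one]
  refine forall₂_congr fun K M => forall₄_congr fun _ _ _ _ => ?_
  have hmul : ∀ a b : ℝ≥0∞, c * a * (c * b) = c * c * (a * b) := fun a b => mul_mul_mul_comm ..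
  rw [← Set.image_inter (gnomonic_injective n), h, h, h, hhemi, ge_iff_le, ge_iff_le,
    mul_right_comm c _ c, hmul,
    ENNReal.mul_le_mul_iff_right (mul_ne_zero hc0 hc0) (ENNReal.mul_ne_top hc hc)]
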